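/- If there exists no contextual word for μ, then there exists a non-contextual value assignment l : C(μ) → ℤ_d. -/

import Mathlib

/-- `Σ𝒮(s)`: the sum over inversions of the word `s`. -/
def invSum (n d : ℕ) (μ : Fin n → Fin n → ZMod d) : List (Fin n) → ZMod d
  | [] => 0
  | x :: s => (s.map (fun y => if y < x then μ x y else 0)).sum + invSum n d μ s

/-- `Σ𝒮(s,t)`: the sum over inversions between `s` and `t`. -/
def invSum2 (n d : ℕ) (μ : Fin n → Fin n → ZMod d) (s t : List (Fin n)) : ZMod d :=
  (s.map (fun x => (t.map (fun y => if y < x then μ x y else 0)).sum)).sum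

/-- The formal commutator `⟦s,t⟧ := Σ𝒮(s,t) − Σ𝒮(t,s)`. -/
def fcomm (n d : ℕ) (μ : Fin n → Fin n → ZMod d) (s t : List (Fin n)) : ZMod d :=
  invSum2 n d μ s t - invSum2 n d μ t s

/-- Bracketings: binary trees with leaves labelled by generators. -/
inductive Brack (n : ℕ) : Type where
  | leaf : Fin n → Brack n
  | node : Brack n → Brack n → Brack n

/-- `∂(β)`: the word of leaf labels of a bracketing. -/
def Brack.word {n : ℕ} : Brack n → List (Fin n)
  | .leaf x => [x]
  | .node b₁ b₂ => b₁.word ++ b₂.word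

/-- A bracketing witnesses commuting products if `⟦∂(β₁), ∂(β₂)⟧ = 0` at every internal node. -/
def Brack.Ok (n d : ℕ) (μ : Fin n → Fin n → ZMod d) : Brack n → Prop
  | .leaf _ => True
  | .node b₁ b₂ =>
      fcomm n d μ b₁.word b₂.word = 0 ∧ Brack.Ok n d μ b₁ ∧ Brack.Ok n d μ b₂

/-- `w` is formed out of commuting products. -/
def Commuting (n d : ℕ) (μ : Fin n → Fin n → ZMod d) (w : List (Fin n)) : Prop :=
  ∃ β : Brack n, Brack.Ok n d μ β ∧ β.word = w

/-- A contextual word for μ. -/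
def ContextualWord (n d : ℕ) (μ : Fin n → Fin n → ZMod d) (w : List (Fin n)) : Prop :=
  w ≠ [] ∧ (∀ x : Fin n, d ∣ w.count x) ∧ Commuting n d μ w ∧ invSum n d μ w ≠ 0

/-- The strictly-lower-triangular pairing `μ̌(k⃗, l⃗) = k⃗ᵀ μ̌ l⃗`. -/
def cPair (n d : ℕ) (μ : Fin n → Fin n → ZMod d) (k l : Fin n → ZMod d) : ZMod d :=
  ∑ i, ∑ j, if j < i then k i * μ i j * l j else 0

/-- The product of the group H(μ). -/
def Hmul (n d : ℕ) (μ : Fin n → Fin n → ZMod d)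
    (g h : ZMod d × (Fin n → ZMod d)) : ZMod d × (Fin n → ZMod d) :=
  (g.1 + h.1 + cPair n d μ g.2 h.2, g.2 + h.2)

/-- C(μ): the smallest subset of H(μ) containing the scalars `(k, 0⃗)` and the
generators `(0, eᵢ)`, closed under products of commuting elements. -/
inductive InC (n d : ℕ) (μ : Fin n → Fin n → ZMod d) : ZMod d × (Fin n → ZMod d) → Prop where
  | scalar (k : ZMod d) : InC n d μ (k, 0)
  | gen (i : Fin n) : InC n d μ (0, Pi.single i 1)
  | mul {g h : ZMod d × (Fin n → ZMod d)} : InC n d μ g → InC n d μ h →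
      Hmul n d μ g h = Hmul n d μ h g → InC n d μ (Hmul n d μ g h)

/-- A non-contextual value assignment on C(μ). -/
def NCVA (n d : ℕ) (μ : Fin n → Fin n → ZMod d)
    (l : ZMod d × (Fin n → ZMod d) → ZMod d) : Prop :=
  (∀ k : ZMod d, l (k, 0) = k) ∧
  ∀ g h : ZMod d × (Fin n → ZMod d), InC n d μ g → InC n d μ h →
    Hmul n d μ g h = Hmul n d μ h g → l (Hmul n d μ g h) = l g + l h

/-- The class in `ℤ_dⁿ` of a word: its vector of letter multiplicities. -/
def wordVec (n d : ℕ) (w : List (Fin n)) : Fin n → ZMod d := fun i => (w.count i : ZMod d)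

section Pairing

variable (n d : ℕ) (μ : Fin n → Fin n → ZMod d)

lemma wordVec_nil : wordVec n d [] = 0 := by
  funext i; simp [wordVec]

lemma wordVec_cons (x : Fin n) (s : List (Fin n)) :
    wordVec n d (x :: s) = Pi.single x 1 + wordVec n d s := by
  funext i
  by_cases h : x = i
  · subst h; simp [wordVec, add_comm]
  · simp [wordVec, h, Ne.symm h]

lemma wordVec_append (s t : List (Fin n)) :
    wordVec n d (s ++ t) = wordVec n d s + wordVec n d t := by
  funext i; simp [wordVec]

lemma cPair_add_left (k k' l : Fin n → ZMod d) :
    cPair n d μ (k + k') l = cPair n d μ k l + cPair n d μ k' l := by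
  simp only [cPair, ← Finset.sum_add_distrib]
  refine Finset.sum_congr rfl fun i _ => Finset.sum_congr rfl fun j _ => ?_
  split_ifs
  · simp only [Pi.add_apply]; ring
  · simp

lemma cPair_add_right (k l l' : Fin n → ZMod d) :
    cPair n d μ k (l + l') = cPair n d μ k l + cPair n d μ k l' := by
  simp only [cPair, ← Finset.sum_add_distrib]
  refine Finset.sum_congr rfl fun i _ => Finset.sum_congr rfl fun j _ => ?_
  split_ifs
  · simp only [Pi.add_apply]; ring
  · simp

lemma cPair_zero_left (l : Fin n → ZMod d) : cPair n d μ 0 l = 0 := by simp [cPair]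

lemma cPair_zero_right (k : Fin n → ZMod d) : cPair n d μ k 0 = 0 := by simp [cPair]

lemma cPair_nsmul_left (m : ℕ) (k l : Fin n → ZMod d) :
    cPair n d μ (m • k) l = m * cPair n d μ k l := by
  induction m with
  | zero => simp [cPair_zero_left]
  | succ m ih => rw [succ_nsmul, cPair_add_left, ih]; push_cast; ring

lemma cPair_nsmul_right (m : ℕ) (k l : Fin n → ZMod d) :
    cPair n d μ k (m • l) = m * cPair n d μ k l := by
  induction m with
  | zero => simp [cPair_zero_right]
  | succ m ih => rw [succ_nsmul, cPair_add_right, ih]; push_cast; ring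

lemma cPair_single_single (x y : Fin n) :
    cPair n d μ (Pi.single x 1) (Pi.single y 1) = if y < x then μ x y else 0 := by
  rw [cPair, Finset.sum_eq_single x, Finset.sum_eq_single y]
  · simp
  · intro j _ hj; simp [hj]
  · simp
  · intro i _ hi; simp [hi]
  · simp

lemma sum_map_eq_cPair_single (x : Fin n) (t : List (Fin n)) :
    (t.map (fun y => if y < x then μ x y else 0)).sum =
      cPair n d μ (Pi.single x 1) (wordVec n d t) := by
  induction t with
  | nil => simp [wordVec_nil, cPair_zero_right]
  | cons y t ih =>
    rw [List.map_cons, List.sum_cons, ih, wordVec_cons, cPair_add_right, cPair_single_single]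

lemma invSum2_eq_cPair (s t : List (Fin n)) :
    invSum2 n d μ s t = cPair n d μ (wordVec n d s) (wordVec n d t) := by
  induction s with
  | nil => simp [invSum2, wordVec_nil, cPair_zero_left]
  | cons x s ih =>
    rw [wordVec_cons, cPair_add_left, ← ih, ← sum_map_eq_cPair_single]
    simp [invSum2]

lemma invSum_append (s t : List (Fin n)) :
    invSum n d μ (s ++ t) =
      invSum n d μ s + invSum n d μ t + cPair n d μ (wordVec n d s) (wordVec n d t) := by
  induction s with
  | nil => simp [invSum, wordVec_nil, cPair_zero_left]
  | cons x s ih =>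
    simp only [List.cons_append, invSum, ih, sum_map_eq_cPair_single, wordVec_cons,
      wordVec_append, cPair_add_left, cPair_add_right]
    ring

lemma fcomm_eq_zero_iff (s t : List (Fin n)) :
    fcomm n d μ s t = 0 ↔
      cPair n d μ (wordVec n d s) (wordVec n d t) =
        cPair n d μ (wordVec n d t) (wordVec n d s) := by
  rw [fcomm, sub_eq_zero, invSum2_eq_cPair, invSum2_eq_cPair]

lemma Hmul_comm_iff (g h : ZMod d × (Fin n → ZMod d)) :
    Hmul n d μ g h = Hmul n d μ h g ↔ cPair n d μ g.2 h.2 = cPair n d μ h.2 g.2 := by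
  simp [Hmul, Prod.ext_iff, add_comm]

end Pairing

section Commuting

variable {n d : ℕ} {μ : Fin n → Fin n → ZMod d}

lemma Brack.word_ne_nil (β : Brack n) : β.word ≠ [] := by
  induction β with
  | leaf x => simp [Brack.word]
  | node b₁ b₂ ih₁ ih₂ => simp [Brack.word, ih₁]

lemma Commuting.append {s t : List (Fin n)} (hs : Commuting n d μ s) (ht : Commuting n d μ t)
    (h : cPair n d μ (wordVec n d s) (wordVec n d t) =
      cPair n d μ (wordVec n d t) (wordVec n d s)) : Commuting n d μ (s ++ t) := by
  obtain ⟨β, hβ, rfl⟩ := hs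
  obtain ⟨γ, hγ, rfl⟩ := ht
  exact ⟨.node β γ, ⟨(fcomm_eq_zero_iff n d μ _ _).2 h, hβ, hγ⟩, rfl⟩

/-- Powers of a commuting word `w` are commuting; the sum over inversions of `w ^ (m + 1)` is
expressed through that of `w`. -/
lemma Commuting.exists_pow {w : List (Fin n)} (hw : Commuting n d μ w) (m : ℕ) :
    ∃ u, Commuting n d μ u ∧ wordVec n d u = (m + 1) • wordVec n d w ∧
      invSum n d μ u = (m + 1) * invSum n d μ w +
        ((m + 1).choose 2 : ℕ) * cPair n d μ (wordVec n d w) (wordVec n d w) := by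
  induction m with
  | zero => exact ⟨w, hw, by simp, by simp⟩
  | succ m ih =>
    obtain ⟨u, hu, hv, hi⟩ := ih
    refine ⟨u ++ w, hu.append hw ?_, ?_, ?_⟩
    · rw [hv, cPair_nsmul_left, cPair_nsmul_right]
    · rw [wordVec_append, hv, succ_nsmul _ (m + 1)]
    · rw [invSum_append, hi, hv, cPair_nsmul_left, Nat.choose_succ_succ' (m + 1) 1,
        Nat.choose_one_right]
      push_cast
      ring

lemma Commuting.invSum_eq_zero (hctx : ¬ ∃ w : List (Fin n), ContextualWord n d μ w)
    {w : List (Fin n)} (hw : Commuting n d μ w) (h0 : wordVec n d w = 0) :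
    invSum n d μ w = 0 := by
  by_contra h
  refine hctx ⟨w, ?_, fun x => ?_, hw, h⟩
  · obtain ⟨β, -, rfl⟩ := hw
    exact β.word_ne_nil
  · exact (ZMod.natCast_eq_zero_iff _ _).1 (congrFun h0 x)

/-- Without contextual words, the sum over inversions of a commuting word depends only on its
class in `ℤ_dⁿ`. -/
lemma Commuting.invSum_congr (hd : 2 ≤ d) (hctx : ¬ ∃ w : List (Fin n), ContextualWord n d μ w)
    {s t : List (Fin n)} (hs : Commuting n d μ s) (ht : Commuting n d μ t)
    (h : wordVec n d s = wordVec n d t) : invSum n d μ s = invSum n d μ t := by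
  obtain ⟨m, rfl⟩ := Nat.exists_eq_add_of_le' hd
  have hdv : (m + 2) • wordVec n (m + 2) t = 0 := by
    funext i
    simp [-Nat.cast_add, -Nat.cast_ofNat, nsmul_eq_mul]
  obtain ⟨u, hu, hv, hi⟩ := ht.exists_pow m
  obtain ⟨u', hu', hv', hi'⟩ := ht.exists_pow (m + 1)
  have hsu : Commuting n (m + 2) μ (s ++ u) :=
    hs.append hu (by rw [hv, h, cPair_nsmul_left, cPair_nsmul_right])
  have e₁ := hsu.invSum_eq_zero hctx (by
    rw [wordVec_append, h, hv, ← succ_nsmul', hdv])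
  have e₂ := hu'.invSum_eq_zero hctx (by rw [hv', hdv])
  rw [invSum_append, h, hv, cPair_nsmul_right, hi] at e₁
  rw [hi', Nat.choose_succ_succ' (m + 1) 1, Nat.choose_one_right] at e₂
  push_cast at e₁ e₂
  linear_combination e₁ - e₂

lemma InC.exists_commuting (hn : 1 ≤ n) (hd : 2 ≤ d) {g : ZMod d × (Fin n → ZMod d)}
    (hg : InC n d μ g) : ∃ w, Commuting n d μ w ∧ wordVec n d w = g.2 := by
  have hgen (i : Fin n) : Commuting n d μ [i] ∧ wordVec n d [i] = Pi.single i 1 :=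
    ⟨⟨.leaf i, trivial, rfl⟩, by rw [wordVec_cons, wordVec_nil, add_zero]⟩
  induction hg with
  | scalar k =>
    obtain ⟨u, hu, hv, -⟩ := (hgen ⟨0, hn⟩).1.exists_pow (d - 1)
    refine ⟨u, hu, ?_⟩
    rw [hv, Nat.sub_add_cancel (by omega)]
    funext i
    simp
  | gen i => exact ⟨[i], hgen i⟩
  | mul _ _ hc ihg ihh =>
    obtain ⟨s, hs, hs'⟩ := ihg
    obtain ⟨t, ht, ht'⟩ := ihh
    rw [Hmul_comm_iff, ← hs', ← ht'] at hc
    exact ⟨s ++ t, hs.append ht hc, by rw [wordVec_append, hs', ht', Hmul]⟩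

end Commuting

theorem stmt7 (n d : ℕ) (hn : 1 ≤ n) (hd : 2 ≤ d) (μ : Fin n → Fin n → ZMod d)
    (hskew : ∀ i j, μ i j = - μ j i) (hdiag : ∀ i, μ i i = 0) :
    (¬ ∃ w : List (Fin n), ContextualWord n d μ w) →
    ∃ l : ZMod d × (Fin n → ZMod d) → ZMod d, NCVA n d μ l := by
  intro hctx
  classical
  let f : (Fin n → ZMod d) → ZMod d := fun v =>
    if h : ∃ w, Commuting n d μ w ∧ wordVec n d w = v then invSum n d μ h.choose else 0
  have hf {w : List (Fin n)} (hw : Commuting n d μ w) :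
      f (wordVec n d w) = invSum n d μ w := by
    have h : ∃ u, Commuting n d μ u ∧ wordVec n d u = wordVec n d w := ⟨w, hw, rfl⟩
    simp only [f, dif_pos h]
    exact h.choose_spec.1.invSum_congr hd hctx hw h.choose_spec.2
  refine ⟨fun g => g.1 - f g.2, fun k => ?_, fun g h hg hh hc => ?_⟩
  · obtain ⟨w, hw, h0⟩ := (InC.scalar (μ := μ) k).exists_commuting hn hd
    have h0' : wordVec n d w = 0 := h0
    simp only
    rw [← h0', hf hw, hw.invSum_eq_zero hctx h0', sub_zero]
  · obtain ⟨s, hs, hs'⟩ := hg.exists_commuting hn hd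
    obtain ⟨t, ht, ht'⟩ := hh.exists_commuting hn hd
    rw [Hmul_comm_iff, ← hs', ← ht'] at hc
    simp only [Hmul]
    rw [← hs', ← ht', ← wordVec_append, hf hs, hf ht, hf (hs.append ht hc), invSum_append]
    ring
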